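/- arXiv:1303.2894 — 2 statements merged into one kernel-verified Lean document; each statement's English description precedes it below -/
import Mathlib

section
/- Let X be a finite set, let μ be a determinantal probability distribution on the subsets of X with correlation kernel K : Matrix X X ℝ, and let A ⊆ X. Assume that q := ∑_{T ⊆ X, T ∩ A = ∅} μ(T) > 0 and that the matrix 1_A − K_{AA} is invertible. Set Y := X \ A and define the matrix K_A : Matrix Y Y ℝ by K_A := K_{YY} + K_{YA} (1_A − K_{AA})⁻¹ K_{AY}. Define the conditioned distribution ν on subsets of Y by ν(T) := μ(T)/q if T ∩ A = ∅ and ν(T) := 0 otherwise. Then ν is determinantal with correlation kernel K_A, i.e. for every S ⊆ Y one has ∑_{T ⊆ Y, S ⊆ T} ν(T) = det((K_A).submatrix S S). -/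
open Matrix Finset

/-- The matrix with rows `K i` for `i ∈ S`, rows `eᵢ - K i` for `i ∈ B \ S`, and rows `eᵢ`
elsewhere, where `eᵢ` is the standard basis. Its determinant is the probability that a
determinantal process with kernel `K` contains `S` and avoids `B`. -/
def inclusionExclusionMatrix {X : Type*} [DecidableEq X] (K : Matrix X X ℝ) (S B : Finset X) :
    Matrix X X ℝ :=
  Matrix.of fun i => if i ∈ S then K i else if i ∈ B then Pi.single i 1 - K i else Pi.single i 1

/-- Replacing the rows outside the range of `f` by rows of the identity matrix reduces the
determinant to the principal minor indexed by `f`. -/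
theorem det_ite_row_single {R X ι : Type*} [CommRing R] [Fintype X] [DecidableEq X] [Fintype ι]
    [DecidableEq ι] (L : Matrix X X R) (p : X → Prop) [DecidablePred p] {f : ι → X}
    (hf : Function.Injective f) (hp : ∀ x, p x ↔ x ∈ Set.range f) :
    (Matrix.of fun i => if p i then L i else Pi.single i 1).det = (L.submatrix f f).det := by
  rw [Matrix.twoBlockTriangular_det _ p]
  · have h_one : (Matrix.of fun i => if p i then L i else Pi.single i 1).toSquareBlockProp
        (fun i => ¬ p i) = 1 := by
      ext ⟨i, hi⟩ ⟨j, hj⟩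
      simp [Matrix.toSquareBlockProp, hi, Matrix.one_apply, Pi.single_apply, eq_comm]
    let e : ι ≃ {x // p x} :=
      (Equiv.ofInjective f hf).trans (Equiv.subtypeEquivRight fun x => (hp x).symm)
    rw [h_one, Matrix.det_one, mul_one, ← Matrix.det_submatrix_equiv_self e]
    congr 1
    ext i j
    have hi : p (f i) := (hp _).2 ⟨i, rfl⟩
    simp [e, Matrix.toSquareBlockProp, hi]
  · intro i hi j hj
    have hij : j ≠ i := by rintro rfl; exact hi hj
    simp [hi, hij]

theorem det_inclusionExclusionMatrix_insert {X : Type*} [Fintype X] [DecidableEq X]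
    (K : Matrix X X ℝ) {S B : Finset X} {b : X} (hbS : b ∉ S) (hbB : b ∉ B) :
    (inclusionExclusionMatrix K S (insert b B)).det
      = (inclusionExclusionMatrix K S B).det
        - (inclusionExclusionMatrix K (insert b S) B).det := by
  set M := inclusionExclusionMatrix K S B with hM
  have h_single : M = M.updateRow b (Pi.single b 1) := by
    ext i j
    by_cases h : i = b
    · subst h
      simp [hM, inclusionExclusionMatrix, hbS, hbB]
    · simp [h]
  have h_sub : inclusionExclusionMatrix K S (insert b B)
      = M.updateRow b (Pi.single b 1 + (-1 : ℝ) • K b) := by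
    ext i j
    by_cases h : i = b
    · subst h
      simp [inclusionExclusionMatrix, hbS, sub_eq_add_neg]
    · simp [hM, inclusionExclusionMatrix, h]
  have h_row : inclusionExclusionMatrix K (insert b S) B = M.updateRow b (K b) := by
    ext i j
    by_cases h : i = b
    · subst h
      simp [inclusionExclusionMatrix]
    · simp [hM, inclusionExclusionMatrix, h]
  rw [h_sub, h_row, Matrix.det_updateRow_add, Matrix.det_updateRow_smul, ← h_single]
  ring

theorem sum_superset_disjoint_eq_det {X : Type*} [Fintype X] [DecidableEq X]
    (μ : Finset X → ℝ) (K : Matrix X X ℝ)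
    (hdet : ∀ S : Finset X, (∑ T with S ⊆ T, μ T)
      = (K.submatrix (Subtype.val : ↥S → X) (Subtype.val : ↥S → X)).det)
    (B S : Finset X) (hSB : Disjoint S B) :
    (∑ T with S ⊆ T ∧ Disjoint T B, μ T) = (inclusionExclusionMatrix K S B).det := by
  induction B using Finset.induction_on generalizing S with
  | empty =>
    have h := det_ite_row_single K (· ∈ S) (f := (Subtype.val : ↥S → X))
      Subtype.val_injective (by simp)
    simpa [inclusionExclusionMatrix, h] using hdet S
  | insert b B hbB ih =>
    rw [Finset.disjoint_insert_right] at hSB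
    rw [det_inclusionExclusionMatrix_insert K hSB.1 hbB, ← ih S hSB.2,
      ← ih (insert b S) (Finset.disjoint_insert_left.2 ⟨hbB, hSB.2⟩), eq_sub_iff_add_eq,
      ← Finset.sum_filter_add_sum_filter_not (Finset.univ.filter fun T => S ⊆ T ∧ Disjoint T B)
        (fun T => b ∈ T), Finset.filter_filter, Finset.filter_filter, add_comm]
    congr 2 <;> ext T <;>
      simp only [Finset.mem_filter, Finset.mem_univ, true_and, Finset.insert_subset_iff,
        Finset.disjoint_insert_right] <;> tauto

theorem det_inclusionExclusionMatrix_eq_mul {X : Type*} [Fintype X] [DecidableEq X]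
    (K : Matrix X X ℝ) {A S : Finset X} (hS : S ⊆ Aᶜ)
    (hinv : IsUnit (1 - K.submatrix (Subtype.val : ↥A → X) (Subtype.val : ↥A → X)).det) :
    (inclusionExclusionMatrix K S A).det
      = (1 - K.submatrix (Subtype.val : ↥A → X) (Subtype.val : ↥A → X)).det
        * ((K.submatrix (Subtype.val : ↥(Aᶜ) → X) (Subtype.val : ↥(Aᶜ) → X)
            + K.submatrix (Subtype.val : ↥(Aᶜ) → X) (Subtype.val : ↥A → X)
              * (1 - K.submatrix (Subtype.val : ↥A → X) (Subtype.val : ↥A → X))⁻¹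
              * K.submatrix (Subtype.val : ↥A → X) (Subtype.val : ↥(Aᶜ) → X)).submatrix
            (fun i : ↥S => (⟨(i : X), hS i.2⟩ : ↥(Aᶜ)))
            (fun i : ↥S => (⟨(i : X), hS i.2⟩ : ↥(Aᶜ)))).det := by
  let e : ↥A ⊕ ↥(Aᶜ) ≃ X :=
    ((Equiv.refl _).sumCongr (Equiv.subtypeEquivRight fun x => Finset.mem_compl)).trans
      (Equiv.sumCompl (· ∈ A))
  have he_inl (a : ↥A) : e (Sum.inl a) = a := rfl
  have he_inr (y : ↥(Aᶜ)) : e (Sum.inr y) = y := rfl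
  have hA (a : ↥A) : (a : X) ∉ S := fun h => Finset.mem_compl.1 (hS h) a.2
  have hY (y : ↥(Aᶜ)) : (y : X) ∉ A := Finset.mem_compl.1 y.2
  have hYA (y : ↥(Aᶜ)) (a : ↥A) : (a : X) ≠ y := fun h => hY y (h ▸ a.2)
  have h_blocks : (inclusionExclusionMatrix K S A).submatrix e e = Matrix.fromBlocks
      (1 - K.submatrix (Subtype.val : ↥A → X) (Subtype.val : ↥A → X))
      (-K.submatrix (Subtype.val : ↥A → X) (Subtype.val : ↥(Aᶜ) → X))
      (Matrix.of fun (y : ↥(Aᶜ)) (a : ↥A) => if (y : X) ∈ S then K y a else 0)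
      (Matrix.of fun y : ↥(Aᶜ) => if (y : X) ∈ S then fun z : ↥(Aᶜ) => K y z else Pi.single y 1) := by
    ext (i | i) (j | j)
    · simp [he_inl, inclusionExclusionMatrix, hA, Matrix.one_apply, Pi.single_apply,
        eq_comm]
    · simp [he_inl, he_inr, inclusionExclusionMatrix, hA, (hYA j i).symm]
    · by_cases h : (i : X) ∈ S <;>
        simp [he_inl, he_inr, inclusionExclusionMatrix, h, hY, hYA i j]
    · by_cases h : (i : X) ∈ S <;>
        simp [he_inr, inclusionExclusionMatrix, h, hY, Pi.single_apply]
  let _ := Matrix.invertibleOfIsUnitDet _ hinv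
  rw [← Matrix.det_submatrix_equiv_self e, h_blocks, Matrix.det_fromBlocks₁₁,
    Matrix.invOf_eq_nonsing_inv]
  congr 1
  rw [← det_ite_row_single _ (fun y : ↥(Aᶜ) => (y : X) ∈ S)
    (f := fun i : ↥S => (⟨(i : X), hS i.2⟩ : ↥(Aᶜ)))
    (fun i j h => Subtype.ext (congrArg (fun y : ↥(Aᶜ) => (y : X)) h))
    (fun y => ⟨fun h => ⟨⟨y, h⟩, rfl⟩, by rintro ⟨i, rfl⟩; exact i.2⟩)]
  congr 1
  ext y z
  by_cases h : (y : X) ∈ S <;> simp [h, Matrix.mul_apply]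

/-- A determinantal probability distribution on subsets of a finite set `X`,
conditioned to have no points in `A ⊆ X`, is again determinantal on `Y = X \ A`
with kernel `K_A = K_{YY} + K_{YA} (1_A − K_{AA})⁻¹ K_{AY}`. -/
theorem conditioned_process_is_determinantal
    {X : Type*} [Fintype X] [DecidableEq X]
    (μ : Finset X → ℝ) (K : Matrix X X ℝ)
    (hμ_nonneg : ∀ T : Finset X, 0 ≤ μ T)
    (hμ_total : ∑ T : Finset X, μ T = 1)
    (hdet : ∀ S : Finset X,
      (∑ T ∈ Finset.univ.filter (fun T : Finset X => S ⊆ T), μ T)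
        = (K.submatrix (Subtype.val : ↥S → X) (Subtype.val : ↥S → X)).det)
    (A : Finset X)
    (q : ℝ)
    (hq : q = ∑ T ∈ Finset.univ.filter (fun T : Finset X => T ∩ A = ∅), μ T)
    (hq_pos : 0 < q)
    (hinv : IsUnit
      (1 - K.submatrix (Subtype.val : ↥A → X) (Subtype.val : ↥A → X)).det)
    (KA : Matrix ↥(Aᶜ) ↥(Aᶜ) ℝ)
    (hKA : KA =
      K.submatrix (Subtype.val : ↥(Aᶜ) → X) (Subtype.val : ↥(Aᶜ) → X)
      + K.submatrix (Subtype.val : ↥(Aᶜ) → X) (Subtype.val : ↥A → X)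
        * (1 - K.submatrix (Subtype.val : ↥A → X) (Subtype.val : ↥A → X))⁻¹
        * K.submatrix (Subtype.val : ↥A → X) (Subtype.val : ↥(Aᶜ) → X))
    (ν : Finset X → ℝ)
    (hν : ∀ T : Finset X, ν T = if T ∩ A = ∅ then μ T / q else 0) :
    ∀ (S : Finset X) (hS : S ⊆ Aᶜ),
      (∑ T ∈ Finset.univ.filter (fun T : Finset X => T ⊆ Aᶜ ∧ S ⊆ T), ν T)
        = (KA.submatrix
            (fun i : ↥S => (⟨(i : X), hS i.2⟩ : ↥(Aᶜ)))
            (fun i : ↥S => (⟨(i : X), hS i.2⟩ : ↥(Aᶜ)))).det := by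
  intro S hS
  have h_disj : Disjoint S A :=
    Finset.disjoint_left.2 fun x hx => Finset.mem_compl.1 (hS hx)
  have h_q : q = (1 - K.submatrix (Subtype.val : ↥A → X) (Subtype.val : ↥A → X)).det := by
    have h := sum_superset_disjoint_eq_det μ K hdet A ∅ (Finset.disjoint_empty_left A)
    rw [det_inclusionExclusionMatrix_eq_mul K (Finset.empty_subset _) hinv,
      Matrix.det_isEmpty (n := ↥(∅ : Finset X)), mul_one] at h
    simpa [hq, Finset.disjoint_iff_inter_eq_empty] using h
  have h_sum : (∑ T with T ⊆ Aᶜ ∧ S ⊆ T, ν T) = (∑ T with S ⊆ T ∧ Disjoint T A, μ T) / q := by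
    rw [Finset.sum_div]
    refine Finset.sum_congr ?_ fun T hT => ?_
    · ext T
      simp [Finset.subset_compl_iff_disjoint_right, and_comm]
    · rw [hν, if_pos (Finset.disjoint_iff_inter_eq_empty.1 (Finset.mem_filter.1 hT).2.2)]
  rw [h_sum, sum_superset_disjoint_eq_det μ K hdet A S h_disj,
    det_inclusionExclusionMatrix_eq_mul K hS hinv, ← h_q, hKA, mul_div_cancel_left₀ _ hq_pos.ne']
end

section
/- Let X be a finite set and let μ be a determinantal probability distribution on the subsets of X with correlation kernel K : Matrix X X ℝ. Let A ⊆ X and let E_1, …, E_k ⊆ X \ A be pairwise disjoint subsets; set E := E_1 ∪ ⋯ ∪ E_k and assume q := ∑_{T ⊆ X, T ∩ A = ∅} μ(T) > 0. Then for all z_1, …, z_k ∈ ℝ the conditional generating function of occupation numbers satisfies (∑_{T ⊆ X, T ∩ A = ∅} μ(T) ∏_{j=1}^k z_j^{|T ∩ E_j|}) / q = det(1_X − (Π_A + ∑_{j=1}^k (1 − z_j) Π_{E_j}) · K · Π_{E ∪ A}) / det(1_A − K_{AA}), with the convention 0^0 = 1. -/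
open Matrix Finset

/-- Expansion of `det (1 + D * M)` for a diagonal matrix `D` in the principal minors of `M`. -/
theorem det_one_add_diagonal_mul {X R : Type*} [Fintype X] [DecidableEq X] [CommRing R]
    (d : X → R) (M : Matrix X X R) :
    (1 + diagonal d * M).det
      = ∑ S : Finset X, (∏ i ∈ S, d i)
          * (M.submatrix (Subtype.val : ↥S → X) (Subtype.val : ↥S → X)).det := by
  rw [add_comm]
  change detRowAlternating (fun i => (diagonal d * M) i + (1 : Matrix X X R) i) = _
  refine (detRowAlternating.map_add_univ (fun i => (diagonal d * M) i)
    (fun i => (1 : Matrix X X R) i)).trans (Finset.sum_congr rfl fun S _ => ?_)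
  have hrow : S.piecewise (fun i => (diagonal d * M) i) (fun i => (1 : Matrix X X R) i)
      = fun i => (if i ∈ S then d i else 1) • S.piecewise M.row (1 : Matrix X X R).row i := by
    funext i j
    by_cases h : i ∈ S <;> simp [h, diagonal_mul, Finset.piecewise]
  rw [hrow]
  refine (detRowAlternating.map_smul_univ _ _).trans ?_
  rw [Finset.prod_ite_mem, Finset.univ_inter, smul_eq_mul]
  exact congrArg _ (det_piecewise_one_eq_submatrix_det M S)

/-- The generating functional of a determinantal measure on subsets is `det (1 - D * K)`. -/
theorem det_one_sub_diagonal_mul_eq_sum {X R : Type*} [Fintype X] [DecidableEq X] [CommRing R]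
    (μ : Finset X → R) (K : Matrix X X R)
    (hdet : ∀ S : Finset X,
      (∑ T ∈ Finset.univ.filter (fun T : Finset X => S ⊆ T), μ T)
        = (K.submatrix (Subtype.val : ↥S → X) (Subtype.val : ↥S → X)).det)
    (d : X → R) :
    (1 - diagonal d * K).det = ∑ T : Finset X, μ T * ∏ x ∈ T, (1 - d x) := by
  have hneg : 1 - diagonal d * K = 1 + diagonal (fun x => -d x) * K := by
    rw [sub_eq_add_neg, ← Matrix.neg_mul, diagonal_neg]
  rw [hneg, det_one_add_diagonal_mul]
  simp_rw [← hdet, Finset.sum_filter, Finset.mul_sum]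
  rw [Finset.sum_comm]
  refine Finset.sum_congr rfl fun T _ => ?_
  simp_rw [sub_eq_add_neg]
  rw [Finset.prod_one_add, Finset.mul_sum]
  simp_rw [mul_ite, mul_zero]
  rw [← Finset.sum_filter]
  refine Finset.sum_congr (by ext; simp) fun S _ => mul_comm _ _

/-- The determinant of `1 - K_AA` on `A` is that of `1 - Π_A * K` on the whole index set. -/
theorem det_one_sub_submatrix_eq {X R : Type*} [Fintype X] [DecidableEq X] [CommRing R]
    (K : Matrix X X R) (A : Finset X) :
    (1 - K.submatrix (Subtype.val : ↥A → X) (Subtype.val : ↥A → X)).det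
      = (1 - diagonal (fun x : X => if x ∈ A then (1 : R) else 0) * K).det := by
  have hproj : diagonal (fun x : X => if x ∈ A then (1 : R) else 0)
      = (1 : Matrix X X R).submatrix id (Subtype.val : ↥A → X)
        * (1 : Matrix X X R).submatrix (Subtype.val : ↥A → X) id := by
    ext i j
    simp only [mul_apply, submatrix_apply, id_eq, one_apply, diagonal_apply, ite_mul, one_mul,
      zero_mul]
    rw [Finset.sum_coe_sort A (fun x => if i = x then if x = j then (1 : R) else 0 else 0)]
    rw [Finset.sum_ite_eq]
    split_ifs <;> rfl
  have hsub : K.submatrix (Subtype.val : ↥A → X) (Subtype.val : ↥A → X)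
      = (1 : Matrix X X R).submatrix (Subtype.val : ↥A → X) id * K
        * (1 : Matrix X X R).submatrix id (Subtype.val : ↥A → X) := by
    ext i j
    simp [mul_apply, one_apply]
  rw [hsub, hproj, det_one_sub_mul_comm, ← Matrix.mul_assoc]

/-- The multiplicative functional attached to the weight `1_A + ∑ j, (1 - z j) 1_{E j}`. -/
theorem prod_one_sub_indicator_eq {X R : Type*} [DecidableEq X] [CommRing R]
    (A : Finset X) {k : ℕ} (E : Fin k → Finset X)
    (hEA : ∀ j : Fin k, Disjoint (E j) A)
    (hdisj : ∀ i j : Fin k, i ≠ j → Disjoint (E i) (E j))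
    (z : Fin k → R) (T : Finset X) :
    ∏ x ∈ T, (1 - ((if x ∈ A then (1 : R) else 0)
        + ∑ j : Fin k, (1 - z j) * (if x ∈ E j then (1 : R) else 0)))
      = if T ∩ A = ∅ then ∏ j : Fin k, z j ^ (T ∩ E j).card else 0 := by
  split_ifs with hTA
  · have hfactor : ∀ x ∈ T, (1 - ((if x ∈ A then (1 : R) else 0)
        + ∑ j : Fin k, (1 - z j) * (if x ∈ E j then (1 : R) else 0)))
        = ∏ j : Fin k, if x ∈ E j then z j else 1 := by
      intro x hx
      have hxA : x ∉ A := fun h => by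
        have := Finset.mem_inter.2 ⟨hx, h⟩
        simp [hTA] at this
      by_cases hxE : ∃ j, x ∈ E j
      · obtain ⟨j, hj⟩ := hxE
        have hother : ∀ i, i ≠ j → x ∉ E i := fun i hij h =>
          Finset.disjoint_left.1 (hdisj i j hij) h hj
        rw [Fintype.sum_eq_single j fun i hi => by simp [hother i hi],
          Fintype.prod_eq_single j fun i hi => by simp [hother i hi]]
        simp [hxA, hj]
      · push Not at hxE
        simp [hxA, hxE]
    rw [Finset.prod_congr rfl hfactor, Finset.prod_comm]
    refine Finset.prod_congr rfl fun j _ => ?_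
    rw [Finset.prod_ite_mem, Finset.prod_const]
  · obtain ⟨x, hx⟩ := Finset.nonempty_iff_ne_empty.2 hTA
    rw [Finset.mem_inter] at hx
    refine Finset.prod_eq_zero hx.1 ?_
    have hxE : ∀ j, x ∉ E j := fun j h => Finset.disjoint_left.1 (hEA j) h hx.2
    simp [hx.2, hxE]

/-- The finite-state form of equations (condoccprop) and (freddet2) of Appendix A of the
paper: the generating function of occupation numbers of the process conditioned to have
no points in `A` equals `F(E ⊔ A; (z,0)) / F(A; 0)`, a ratio of two determinants. -/
theorem conditioned_generating_function_ratio
    {X : Type*} [Fintype X] [DecidableEq X]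
    (μ : Finset X → ℝ) (K : Matrix X X ℝ)
    (hμ_nonneg : ∀ T : Finset X, 0 ≤ μ T)
    (hμ_total : ∑ T : Finset X, μ T = 1)
    (hdet : ∀ S : Finset X,
      (∑ T ∈ Finset.univ.filter (fun T : Finset X => S ⊆ T), μ T)
        = (K.submatrix (Subtype.val : ↥S → X) (Subtype.val : ↥S → X)).det)
    (A : Finset X)
    {k : ℕ} (E : Fin k → Finset X)
    (hEA : ∀ j : Fin k, Disjoint (E j) A)
    (hdisj : ∀ i j : Fin k, i ≠ j → Disjoint (E i) (E j))
    (q : ℝ)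
    (hq : q = ∑ T ∈ Finset.univ.filter (fun T : Finset X => T ∩ A = ∅), μ T)
    (hq_pos : 0 < q)
    (z : Fin k → ℝ) :
    (∑ T ∈ Finset.univ.filter (fun T : Finset X => T ∩ A = ∅),
        μ T * ∏ j : Fin k, (z j) ^ (T ∩ E j).card) / q
      = ((1 : Matrix X X ℝ)
          - (Matrix.diagonal (fun x : X => if x ∈ A then (1 : ℝ) else 0)
              + ∑ j : Fin k, (1 - z j)
                  • Matrix.diagonal (fun x : X => if x ∈ E j then (1 : ℝ) else 0))
            * K
            * Matrix.diagonal
              (fun x : X => if x ∈ Finset.univ.biUnion E ∪ A then (1 : ℝ) else 0)).det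
        / ((1 : Matrix ↥A ↥A ℝ)
            - K.submatrix (Subtype.val : ↥A → X) (Subtype.val : ↥A → X)).det := by
  have hweight : Matrix.diagonal (fun x : X => if x ∈ A then (1 : ℝ) else 0)
      + ∑ j : Fin k, (1 - z j) • Matrix.diagonal (fun x : X => if x ∈ E j then (1 : ℝ) else 0)
      = Matrix.diagonal (fun x : X => (if x ∈ A then (1 : ℝ) else 0)
        + ∑ j : Fin k, (1 - z j) * (if x ∈ E j then (1 : ℝ) else 0)) := by
    ext x y
    by_cases h : x = y
    · subst h
      simp [Matrix.sum_apply]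
    · simp [Matrix.sum_apply, h]
  congr 1
  · rw [hweight, det_one_sub_mul_comm, ← Matrix.mul_assoc, diagonal_mul_diagonal]
    have hsupport : (fun x : X => (if x ∈ Finset.univ.biUnion E ∪ A then (1 : ℝ) else 0)
        * ((if x ∈ A then (1 : ℝ) else 0)
          + ∑ j : Fin k, (1 - z j) * (if x ∈ E j then (1 : ℝ) else 0)))
        = fun x : X => (if x ∈ A then (1 : ℝ) else 0)
          + ∑ j : Fin k, (1 - z j) * (if x ∈ E j then (1 : ℝ) else 0) := by
      funext x
      by_cases h : x ∈ Finset.univ.biUnion E ∪ A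
      · rw [if_pos h, one_mul]
      · rw [if_neg h, zero_mul]
        simp only [Finset.mem_union, Finset.mem_biUnion, Finset.mem_univ, true_and, not_or,
          not_exists] at h
        simp [h.1, h.2]
    rw [hsupport, det_one_sub_diagonal_mul_eq_sum μ K hdet, Finset.sum_filter]
    refine Finset.sum_congr rfl fun T _ => ?_
    rw [prod_one_sub_indicator_eq A E hEA hdisj z T, mul_ite, mul_zero]
  · rw [hq, det_one_sub_submatrix_eq, det_one_sub_diagonal_mul_eq_sum μ K hdet, Finset.sum_filter]
    refine Finset.sum_congr rfl fun T _ => ?_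
    have h := prod_one_sub_indicator_eq A (fun j : Fin 0 => j.elim0) (fun j => j.elim0)
      (fun j => j.elim0) (fun j => (j.elim0 : ℝ)) T
    simp only [Finset.univ_eq_empty, Finset.sum_empty, Finset.prod_empty, add_zero] at h
    rw [h, mul_ite, mul_one, mul_zero]
end
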